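/- Let n >= 2, let q be a prime power, and let -1 <= i <= n-2. Let pi and pi' be n-dimensional projective subspaces of PG(2n+1,q^2) such that both pi intersect pi^sigma and pi' intersect pi'^sigma have projective dimension i. Let P be a point of H(2n+1,q^2) lying on pi but not on pi intersect pi^sigma, and let P' be a point of H(2n+1,q^2) lying on pi^sigma but not on pi intersect pi^sigma; let Q and Q' be chosen analogously for pi'. Then the number of generators mu of H(2n+1,q^2) such that P is the unique point lying on both mu and pi and P' is the unique point lying on both mu and pi^sigma equals the number of generators mu' such that Q is the unique point lying on both mu' and pi' and Q' is the unique point lying on both mu' and pi'^sigma. -/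

import Mathlib

open scoped BigOperators

namespace HermCode

/-- The Hermitian sesquilinear form `h(x,y) = ∑ᵢ xᵢ * yᵢ^q` on `F^m`. -/
def herm (q : ℕ) {F : Type} [Field F] {m : ℕ} (x y : Fin m → F) : F :=
  ∑ i, x i * (y i) ^ q

/-- For a fixed vector `x`, the linear map `y ↦ h(y,x)`. -/
def hermL (q : ℕ) {F : Type} [Field F] {m : ℕ} (x : Fin m → F) :
    (Fin m → F) →ₗ[F] F where
  toFun y := herm q y x
  map_add' a b := by
    simp [herm, add_mul, Finset.sum_add_distrib]
  map_smul' c a := by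
    simp [herm, Finset.mul_sum, mul_assoc]

/-- The image `W^σ` of a subspace `W` under the Hermitian polarity `σ`:
the subspace of all vectors orthogonal to every vector of `W`
with respect to the Hermitian form. -/
def polar (q : ℕ) {F : Type} [Field F] {m : ℕ} (W : Submodule F (Fin m → F)) :
    Submodule F (Fin m → F) :=
  ⨅ x : W, LinearMap.ker (hermL q (x : Fin m → F))

/-- A subspace all of whose points lie on the Hermitian variety. -/
def TotallyIsotropic (q : ℕ) {F : Type} [Field F] {m : ℕ}
    (W : Submodule F (Fin m → F)) : Prop :=
  ∀ x ∈ W, herm q x x = 0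

/-- A point of the Hermitian variety: a projective point (1-dimensional subspace)
spanned by an isotropic vector. -/
def IsHermPoint (q : ℕ) {F : Type} [Field F] {m : ℕ}
    (P : Submodule F (Fin m → F)) : Prop :=
  Module.finrank F P = 1 ∧ TotallyIsotropic q P

/-- A generator of `H(2n+1,q²)`: an `n`-dimensional projective subspace all of
whose points lie on the Hermitian variety. -/
def IsGenerator (q n : ℕ) {F : Type} [Field F]
    (W : Submodule F (Fin (2*n+2) → F)) : Prop :=
  Module.finrank F W = n + 1 ∧ TotallyIsotropic q W

/-- A code word of the dual code `C_n(H(2n+1,q²))^⊥`: a function from points to `F_p`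
(vanishing off the Hermitian variety) summing to zero over every generator. -/
def IsCodeword (p q n : ℕ) {F : Type} [Field F]
    (c : Submodule F (Fin (2*n+2) → F) → ZMod p) : Prop :=
  (∀ P, ¬ IsHermPoint q P → c P = 0) ∧
  ∀ μ, IsGenerator q n μ → (∑ᶠ P ∈ {P | IsHermPoint q P ∧ P ≤ μ}, c P) = 0

/-- The (Hamming) weight of a code word. -/
noncomputable def wt {p : ℕ} {α : Type*} (c : α → ZMod p) : ℕ :=
  Nat.card {x : α // c x ≠ 0}

open scoped Classical in
/-- The incidence vector `v_π` of `π ∩ H`. -/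
noncomputable def vsub (p q : ℕ) {F : Type} [Field F] {m : ℕ}
    (π : Submodule F (Fin m → F)) : Submodule F (Fin m → F) → ZMod p :=
  fun P => if IsHermPoint q P ∧ P ≤ π then 1 else 0

/-- `θ_m(q)`, the number of points of `PG(m,q)`. -/
noncomputable def theta (q : ℕ) (m : ℤ) : ℚ :=
  ((q:ℚ)^(m+1) - 1) / ((q:ℚ) - 1)

/-- `μ_m(q²)`, the number of points of `H(m,q²)` (with `μ_{-1} = 0`). -/
noncomputable def muH (q : ℕ) (m : ℤ) : ℚ :=
  (((q:ℚ)^(m+1) - (-1:ℚ)^(m+1)) * ((q:ℚ)^m - (-1:ℚ)^m)) / ((q:ℚ)^2 - 1)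

/-- The number `N(n,i)`. -/
noncomputable def NN (q n : ℕ) (i : ℤ) : ℚ :=
  (q:ℚ)^(((n:ℤ)-1)^2 - ((((n:ℤ)-i-1).toNat.choose 2 : ℕ) : ℤ)) *
    ∏ j ∈ Finset.range ((n:ℤ)-i-2).toNat, ((q:ℚ)^(j+1) - (-1:ℚ)^(j+1))

open scoped Classical in
/-- The quantity `Σ_{n,i}`. -/
noncomputable def SigmaNI (q n : ℕ) (i : ℤ) : ℚ :=
  if Odd ((n:ℤ) - i) then
    2*(q:ℚ)^(2*i+2) * muH q ((n:ℤ)-i-1)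
      + 4 * muH q ((n:ℤ)-i-2) * ((q:ℚ)^((n:ℤ)-i-1) - 1)
          / ((q:ℚ)^((n:ℤ)-3*i-5) * ((q:ℚ)^2 - 1))
  else
    2*(q:ℚ)^(2*i+2) * (muH q ((n:ℤ)-i-1)
      + 2*((q:ℚ)^(4:ℤ) * muH q ((n:ℤ)-i-3) + (q:ℚ)^2 - 1)/((q:ℚ)^2 - 1))

/-- `P` lies on a projective line entirely contained in the Hermitian variety that
meets both `π \ (π ⊓ π^σ)` and `π^σ \ (π ⊓ π^σ)`. -/
def OnGoodLine (q : ℕ) {F : Type} [Field F] {m : ℕ}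
    (π P : Submodule F (Fin m → F)) : Prop :=
  ∃ A B : Submodule F (Fin m → F),
    Module.finrank F A = 1 ∧ A ≤ π ∧ ¬ A ≤ π ⊓ polar q π ∧
    Module.finrank F B = 1 ∧ B ≤ polar q π ∧ ¬ B ≤ π ⊓ polar q π ∧
    P ≤ A ⊔ B ∧ TotallyIsotropic q (A ⊔ B)

structure Cj (q : ℕ) (F : Type) [Field F] : Prop where
  q0 : q ≠ 0
  add : ∀ a b : F, (a + b) ^ q = a ^ q + b ^ q
  inv : ∀ a : F, (a ^ q) ^ q = a
  nrm : ∀ a : F, a ^ q = a → a ≠ 0 → ∃ c : F, c * c ^ q = a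
  tr : ∃ t : F, t + t ^ q = 1

theorem cj_of_card (q p hh : ℕ) (hp : p.Prime) (hh1 : 1 ≤ hh) (hq : q = p ^ hh)
    (F : Type) [Field F] [Fintype F] (hF : Fintype.card F = q ^ 2) : Cj q F := by
  have hq2 : 2 ≤ q := by
    rw [hq]; exact le_trans hp.two_le (Nat.le_self_pow (by omega) p)
  have : Fact p.Prime := ⟨hp⟩
  have : CharP F p := by
    apply charP_of_card_eq_prime_pow (f := hh * 2)
    rw [hF, hq, pow_mul]
  have hadd : ∀ a b : F, (a + b) ^ q = a ^ q + b ^ q := by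
    intro a b; rw [hq]; exact add_pow_char_pow a b p hh
  have hinv : ∀ a : F, (a ^ q) ^ q = a := by
    intro a
    rw [← pow_mul, ← pow_two, ← hF]; exact FiniteField.pow_card a
  classical
  refine ⟨by omega, hadd, hinv, ?_, ?_⟩
  · intro a ha ha0
    obtain ⟨g, hg⟩ := IsCyclic.exists_generator (α := Fˣ)
    obtain ⟨j, hj⟩ := (Subgroup.mem_zpowers_iff).1 (hg (Units.mk0 a ha0))
    have hord : orderOf g = q ^ 2 - 1 := by
      rw [orderOf_eq_card_of_forall_mem_zpowers hg, Nat.card_eq_fintype_card, Fintype.card_units, hF]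
    have h1 : g ^ (j * ((q:ℤ) - 1)) = 1 := by
      rw [zpow_mul, hj, zpow_sub, zpow_one, zpow_natCast]
      rw [mul_inv_eq_one]
      ext; simpa using ha
    rw [← orderOf_dvd_iff_zpow_eq_one, hord] at h1
    have h2 : ((q ^ 2 - 1 : ℕ) : ℤ) = ((q:ℤ) + 1) * ((q:ℤ) - 1) := by
      rw [Nat.cast_sub (Nat.one_le_pow _ _ (by omega))]; push_cast; ring
    rw [h2] at h1
    have h3 : ((q:ℤ) + 1) ∣ j := Int.dvd_of_mul_dvd_mul_right (by omega) h1
    obtain ⟨l, rfl⟩ := h3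
    refine ⟨((g ^ l : Fˣ) : F), ?_⟩
    have : (g ^ l) * (g ^ l) ^ q = Units.mk0 a ha0 := by
      rw [← hj, mul_comm ((q:ℤ)+1), zpow_mul, zpow_add, zpow_one, zpow_natCast, mul_comm]
    have := congrArg Units.val this
    simpa using this
  · have : ∃ x : F, x + x ^ q ≠ 0 := by
      by_contra hcon
      push Not at hcon
      let f : Polynomial F := Polynomial.X + Polynomial.X ^ q
      have hdeg : f.natDegree = q := by
        simp only [f]
        rw [Polynomial.natDegree_add_eq_right_of_natDegree_lt] <;> simp; omega
      have hf0 : f ≠ 0 := by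
        intro h; rw [h] at hdeg; simp at hdeg; omega
      have h1 : Fintype.card F ≤ f.natDegree := by
        classical
        have := Polynomial.card_roots' f
        have h2 : (Finset.univ : Finset F).val ≤ f.roots := by
          rw [Multiset.le_iff_subset Finset.univ.nodup]
          intro x _
          rw [Polynomial.mem_roots hf0]
          simp [f, hcon x]
        exact le_trans (by simpa using Multiset.card_le_card h2) this
      rw [hF, hdeg] at h1
      nlinarith
    obtain ⟨x, hx⟩ := this
    refine ⟨x / (x + x ^ q), ?_⟩
    rw [div_pow, hadd, hinv, add_comm (x ^ q) x, ← add_div, div_self hx]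

section
variable {q : ℕ} {F : Type} [Field F] {m : ℕ}

def Cj.hom (H : Cj q F) : F →+* F where
  toFun a := a ^ q
  map_one' := one_pow _
  map_mul' a b := mul_pow a b q
  map_zero' := zero_pow H.q0
  map_add' := H.add

theorem herm_add_left (x y z : Fin m → F) : herm q (x + y) z = herm q x z + herm q y z :=
  (hermL q z).map_add x y

theorem herm_sub_left (x y z : Fin m → F) : herm q (x - y) z = herm q x z - herm q y z :=
  (hermL q z).map_sub x y

theorem herm_smul_left (c : F) (x z : Fin m → F) : herm q (c • x) z = c * herm q x z :=
  (hermL q z).map_smul c x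

theorem herm_zero_left (z : Fin m → F) : herm q 0 z = 0 := (hermL q z).map_zero

theorem herm_sum_left {ι : Type*} [Fintype ι] (c : ι → F) (b : ι → Fin m → F) (z : Fin m → F) :
    herm q (∑ a, c a • b a) z = ∑ a, c a * herm q (b a) z := by
  have := map_sum (hermL q z) (fun a => c a • b a) Finset.univ
  simp only [map_smul] at this
  exact this

theorem herm_symm (H : Cj q F) (x y : Fin m → F) : herm q y x = (herm q x y) ^ q := by
  change _ = H.hom _
  simp only [herm, map_sum, map_mul]
  apply Finset.sum_congr rfl
  intro i _
  change _ = (x i) ^ q * (y i ^ q) ^ q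
  rw [H.inv, mul_comm]

theorem herm_eq_zero_symm (H : Cj q F) {x y : Fin m → F} (h : herm q x y = 0) :
    herm q y x = 0 := by
  rw [herm_symm H, h, zero_pow H.q0]

theorem herm_add_right (H : Cj q F) (x y z : Fin m → F) :
    herm q z (x + y) = herm q z x + herm q z y := by
  rw [herm_symm H, herm_add_left, H.add, ← herm_symm H, ← herm_symm H]

theorem herm_smul_right (H : Cj q F) (c : F) (x z : Fin m → F) :
    herm q z (c • x) = c ^ q * herm q z x := by
  rw [herm_symm H, herm_smul_left, mul_pow, ← herm_symm H]

theorem herm_sub_right (H : Cj q F) (x y z : Fin m → F) :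
    herm q z (x - y) = herm q z x - herm q z y := by
  rw [herm_symm H, herm_sub_left]
  change H.hom _ = _
  rw [map_sub]
  change (herm q x z) ^ q - (herm q y z) ^ q = _
  rw [← herm_symm H, ← herm_symm H]

theorem herm_sum_right (H : Cj q F) {ι : Type*} [Fintype ι] (c : ι → F) (b : ι → Fin m → F)
    (z : Fin m → F) :
    herm q z (∑ a, c a • b a) = ∑ a, (c a) ^ q * herm q z (b a) := by
  rw [herm_symm H, herm_sum_left]
  change H.hom _ = _
  rw [map_sum]
  apply Finset.sum_congr rfl
  intro a _
  change (c a * herm q (b a) z) ^ q = _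
  rw [mul_pow, ← herm_symm H]

theorem mem_polar {W : Submodule F (Fin m → F)} {y : Fin m → F} :
    y ∈ polar q W ↔ ∀ x ∈ W, herm q y x = 0 := by
  simp only [polar, Submodule.mem_iInf, LinearMap.mem_ker, Subtype.forall]
  rfl

theorem mem_polar_span (H : Cj q F) {ι : Type*} [Fintype ι] {b : ι → Fin m → F}
    {y : Fin m → F} :
    y ∈ polar q (Submodule.span F (Set.range b)) ↔ ∀ a, herm q y (b a) = 0 := by
  rw [mem_polar]
  constructor
  · intro h a; exact h _ (Submodule.subset_span ⟨a, rfl⟩)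
  · intro h x hx
    obtain ⟨c, rfl⟩ := (Submodule.mem_span_range_iff_exists_fun F).1 hx
    rw [herm_sum_right H]; simp [h]

/-- nondegenerate subspace -/
def Nd (q : ℕ) {F : Type} [Field F] {m : ℕ} (W : Submodule F (Fin m → F)) : Prop :=
  ∀ x ∈ W, (∀ y ∈ W, herm q y x = 0) → x = 0

theorem nd_top (H : Cj q F) : Nd q (⊤ : Submodule F (Fin m → F)) := by
  classical
  intro x _ h
  funext i
  have := h (Pi.single i 1) trivial
  simp only [herm, Pi.single_apply, ite_mul, one_mul, zero_mul, Finset.sum_ite_eq',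
    Finset.mem_univ, if_true] at this
  exact pow_eq_zero_iff H.q0 |>.1 this

def evL (q : ℕ) {F : Type} [Field F] {m : ℕ} {ι : Type*} (r : ι → Fin m → F) :
    (Fin m → F) →ₗ[F] (ι → F) := LinearMap.pi (fun j => hermL q (r j))

theorem evL_surj (H : Cj q F) {W : Submodule F (Fin m → F)} (hW : Nd q W) {ι : Type*} [Fintype ι]
    {r : ι → Fin m → F} (hr : LinearIndependent F r) (hrW : ∀ j, r j ∈ W) (z : ι → F) :
    ∃ y ∈ W, ∀ j, herm q y (r j) = z j := by
  classical
  have key : LinearMap.range ((evL q r).domRestrict W) = ⊤ := by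
    by_contra hne
    obtain ⟨f, hf0, hf⟩ := Submodule.exists_le_ker_of_lt_top _ (lt_top_iff_ne_top.2 hne)
    apply hf0
    have hfe : ∀ v : ι → F, f v = ∑ j, v j * f (Pi.single j 1) := by
      intro v
      conv_lhs => rw [pi_eq_sum_univ' v]
      simp [map_sum]
    let d : ι → F := fun j => (f (Pi.single j 1)) ^ q
    have hz : ∑ j, d j • r j = 0 := by
      apply hW _ (Submodule.sum_mem _ fun j _ => W.smul_mem _ (hrW j))
      intro y hy
      rw [herm_sum_right H]
      have : f ((evL q r).domRestrict W ⟨y, hy⟩) = 0 := hf ⟨_, rfl⟩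
      rw [hfe] at this
      rw [← this]
      apply Finset.sum_congr rfl
      intro j _
      simp only [d, H.inv]
      rw [mul_comm]; rfl
    have hd := Fintype.linearIndependent_iff.1 hr d hz
    apply LinearMap.ext
    intro v
    rw [hfe]
    apply Finset.sum_eq_zero
    intro j _
    rw [(pow_eq_zero_iff H.q0).1 (hd j), mul_zero]
  have : z ∈ LinearMap.range ((evL q r).domRestrict W) := by rw [key]; trivial
  obtain ⟨⟨y, hy⟩, h⟩ := this
  exact ⟨y, hy, fun j => congrFun h j⟩

theorem finrank_inf_polar (H : Cj q F) {W : Submodule F (Fin m → F)} (hW : Nd q W) {ι : Type*}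
    [Fintype ι] {r : ι → Fin m → F} (hr : LinearIndependent F r) (hrW : ∀ j, r j ∈ W) :
    Module.finrank F ↥(W ⊓ polar q (Submodule.span F (Set.range r))) + Fintype.card ι
      = Module.finrank F W := by
  have h1 := LinearMap.finrank_range_add_finrank_ker ((evL q r).domRestrict W)
  have h2 : LinearMap.range ((evL q r).domRestrict W) = ⊤ := by
    rw [LinearMap.range_eq_top]
    intro z
    obtain ⟨y, hy, h⟩ := evL_surj H hW hr hrW z
    exact ⟨⟨y, hy⟩, funext h⟩
  rw [h2, finrank_top, Module.finrank_fintype_fun_eq_card] at h1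
  have h3 : W ⊓ polar q (Submodule.span F (Set.range r))
      = (LinearMap.ker ((evL q r).domRestrict W)).map W.subtype := by
    ext y
    simp only [Submodule.mem_inf, mem_polar_span H, Submodule.mem_map, LinearMap.mem_ker]
    constructor
    · rintro ⟨h, h'⟩; exact ⟨⟨y, h⟩, funext h', rfl⟩
    · rintro ⟨⟨y, h⟩, h', rfl⟩; exact ⟨h, fun a => congrFun h' a⟩
  rw [h3, LinearEquiv.finrank_eq (Submodule.equivMapOfInjective W.subtype
    (Submodule.injective_subtype W) _).symm]
  omega

theorem finrank_polar (H : Cj q F) (W : Submodule F (Fin m → F)) :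
    Module.finrank F ↥(polar q W) + Module.finrank F W = m := by
  let b := Module.finBasis F W
  have hr : LinearIndependent F (fun j => (b j : Fin m → F)) :=
    b.linearIndependent.map' W.subtype (Submodule.ker_subtype W)
  have hs : Submodule.span F (Set.range fun j => (b j : Fin m → F)) = W := by
    have : (Set.range fun j => (b j : Fin m → F)) = W.subtype '' Set.range b := by
      rw [← Set.range_comp]; rfl
    rw [this, Submodule.span_image, b.span_eq, Submodule.map_top, Submodule.range_subtype]
  have := finrank_inf_polar H (nd_top H) hr (fun _ => trivial)
  rw [hs, top_inf_eq] at this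
  simpa using this

theorem polar_polar (H : Cj q F) (W : Submodule F (Fin m → F)) : polar q (polar q W) = W := by
  symm
  apply Submodule.eq_of_le_of_finrank_eq
  · intro x hx
    rw [mem_polar]
    intro y hy
    exact herm_eq_zero_symm H (mem_polar.1 hy x hx)
  · have := finrank_polar H W
    have := finrank_polar H (polar q W)
    omega

/-- Gram matrix is the permutation matrix of `τ` -/
def Gram (q : ℕ) {F : Type} [Field F] {m : ℕ} {ι : Type*} [DecidableEq ι]
    (b : ι → Fin m → F) (τ : Equiv.Perm ι) : Prop :=
  ∀ a c, herm q (b a) (b c) = if c = τ a then 1 else 0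

theorem Gram.li {ι : Type*} [Fintype ι] [DecidableEq ι]
    {b : ι → Fin m → F} {τ : Equiv.Perm ι} (hb : Gram q b τ) : LinearIndependent F b := by
  rw [Fintype.linearIndependent_iff]
  intro c hc a
  have := herm_sum_left (q := q) c b (b (τ a))
  rw [hc, herm_zero_left] at this
  simp only [hb _ _, EmbeddingLike.apply_eq_iff_eq, mul_ite, mul_one, mul_zero,
    Finset.sum_ite_eq, Finset.mem_univ, if_true] at this
  exact this.symm

theorem Gram.nd {ι : Type*} (H : Cj q F) [Fintype ι] [DecidableEq ι]
    {b : ι → Fin m → F} {τ : Equiv.Perm ι} (hb : Gram q b τ) {W : Submodule F (Fin m → F)}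
    (hW : Nd q W) (hbW : ∀ a, b a ∈ W) :
    Nd q (W ⊓ polar q (Submodule.span F (Set.range b))) := by
  intro y hy hy2
  obtain ⟨hyW, hyp⟩ := hy
  have hyp' := (mem_polar_span H).1 hyp
  apply hW y hyW
  intro x hx
  have := hy2 (x - ∑ a, herm q x (b (τ a)) • b a) ⟨?_, ?_⟩
  · rw [herm_sub_left, herm_sum_left] at this
    rw [sub_eq_zero] at this
    rw [this]
    apply Finset.sum_eq_zero
    intro a _
    rw [herm_eq_zero_symm H (hyp' a), mul_zero]
  · exact W.sub_mem hx (Submodule.sum_mem _ fun a _ => W.smul_mem _ (hbW a))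
  · refine (mem_polar_span H).2 fun c => ?_
    rw [herm_sub_left, herm_sum_left]
    obtain ⟨c, rfl⟩ := τ.surjective c
    simp [hb _ _]

theorem Gram.sum (H : Cj q F) {ι κ : Type*} [DecidableEq ι] [DecidableEq κ]
    {b : ι → Fin m → F} {τ : Equiv.Perm ι} (hb : Gram q b τ)
    {b' : κ → Fin m → F} {τ' : Equiv.Perm κ} (hb' : Gram q b' τ')
    (h : ∀ a c, herm q (b a) (b' c) = 0) :
    Gram q (Sum.elim b b') (Equiv.sumCongr τ τ') := by
  rintro (a | a) (c | c)
  · simp [hb a c]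
  · simp [h]
  · simp [herm_eq_zero_symm H (h c a)]
  · simp [hb' a c]

theorem exists_aniso (H : Cj q F) {W : Submodule F (Fin m → F)} (hW : Nd q W) (h0 : W ≠ ⊥) :
    ∃ x ∈ W, herm q x x = 1 := by
  have h1 : ∃ x ∈ W, herm q x x ≠ 0 := by
    by_contra hcon
    push Not at hcon
    apply h0
    rw [eq_bot_iff]
    intro x hx
    rw [Submodule.mem_bot]
    apply hW x hx
    intro y hy
    by_contra hne
    obtain ⟨t, ht⟩ := H.tr
    have h2 := hcon ((t / herm q y x) • y + x) (W.add_mem (W.smul_mem _ hy) hx)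
    have h3 : herm q ((t / herm q y x) • y) x = t := by
      rw [herm_smul_left, div_mul_cancel₀ _ hne]
    rw [herm_add_left, herm_add_right H, herm_add_right H, hcon x hx,
      hcon _ (W.smul_mem _ hy), herm_symm H _ x, h3] at h2
    simp [ht] at h2
  obtain ⟨x, hx, hxx⟩ := h1
  obtain ⟨c, hc⟩ := H.nrm (herm q x x)⁻¹ (by rw [inv_pow, ← herm_symm H]) (inv_ne_zero hxx)
  refine ⟨c • x, W.smul_mem _ hx, ?_⟩
  rw [herm_smul_left, herm_smul_right H, ← mul_assoc, hc, inv_mul_cancel₀ hxx]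

theorem exists_onb (H : Cj q F) (t : ℕ) : ∀ (W : Submodule F (Fin m → F)), Nd q W →
    Module.finrank F W = t →
    ∃ e : Fin t → Fin m → F, (∀ a, e a ∈ W) ∧ Gram q e (Equiv.refl _) := by
  induction t with
  | zero => intro W _ _; exact ⟨fun a => a.elim0, fun a => a.elim0, fun a => a.elim0⟩
  | succ t ih =>
    intro W hW hd
    obtain ⟨x, hx, hxx⟩ := exists_aniso H hW (by rintro rfl; simp at hd)
    have hg : Gram q (fun _ : Unit => x) (Equiv.refl _) := by
      intro a c; simp [hxx]
    have hfr := finrank_inf_polar H hW hg.li (fun _ => hx)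
    obtain ⟨e, heW, he⟩ := ih _ (hg.nd H hW (fun _ => hx)) (by simp at hfr ⊢; omega)
    have hex : ∀ a, herm q (e a) x = 0 := fun a => (mem_polar_span H).1 (heW a).2 ()
    refine ⟨Fin.cons x e, ?_, ?_⟩
    · intro a
      refine Fin.cases hx (fun a => (heW a).1) a
    · intro a c
      refine Fin.cases ?_ (fun a => ?_) a <;> refine Fin.cases ?_ (fun c => ?_) c
      · simp [hxx]
      · simp [herm_eq_zero_symm H (hex c)]
      · simp [hex, (Fin.succ_ne_zero a).symm]
      · have := he a c
        simp only [Fin.cons_succ, this, Equiv.refl_apply, Fin.succ_inj]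
        congr

abbrev Jx (s t : ℕ) := (Fin s ⊕ Fin s) ⊕ Fin t

def Jt (s t : ℕ) : Equiv.Perm (Jx s t) :=
  Equiv.sumCongr (Equiv.sumComm (Fin s) (Fin s)) (Equiv.refl _)

theorem exists_std (H : Cj q F) (s t : ℕ) {W : Submodule F (Fin m → F)} (hW : Nd q W)
    (hd : Module.finrank F W = 2 * s + t) {r : Fin s → Fin m → F} (hr : LinearIndependent F r)
    (hrW : ∀ j, r j ∈ W) (hrr : ∀ i j, herm q (r i) (r j) = 0) :
    ∃ b : Jx s t → Fin m → F, (∀ a, b a ∈ W) ∧ Gram q b (Jt s t) ∧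
      ∀ j, b (Sum.inl (Sum.inl j)) = r j := by
  classical
  choose w hwW hw using fun k => evL_surj H hW hr hrW (Pi.single k 1)
  obtain ⟨u, hu⟩ := H.tr
  let w' : Fin s → Fin m → F := fun j => w j - ∑ k, (u * herm q (w j) (w k)) • r k
  have hw'W : ∀ j, w' j ∈ W := fun j =>
    W.sub_mem (hwW j) (Submodule.sum_mem _ fun a _ => W.smul_mem _ (hrW a))
  have hw'r : ∀ j i, herm q (w' j) (r i) = if i = j then 1 else 0 := by
    intro j i
    simp only [w', herm_sub_left, herm_sum_left, hrr, mul_zero, Finset.sum_const_zero, sub_zero,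
      hw, Pi.single_apply]
  have hrw' : ∀ j i, herm q (r i) (w' j) = if i = j then 1 else 0 := by
    intro j i
    rw [herm_symm H, hw'r]; split_ifs <;> simp [H.q0]
  have hw'w' : ∀ j l, herm q (w' j) (w' l) = 0 := by
    intro j l
    have h1 : herm q (w' j) (w' l) = herm q (w' j) (w l) -
        ∑ k, (u * herm q (w l) (w k)) ^ q * herm q (w' j) (r k) := by
      conv_lhs => rw [show w' l = w l - ∑ k, (u * herm q (w l) (w k)) • r k from rfl]
      rw [herm_sub_right H, herm_sum_right H]
    have h2 : herm q (w' j) (w l) = herm q (w j) (w l) - u * herm q (w j) (w l) := by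
      simp only [w', herm_sub_left, herm_sum_left]
      congr 1
      rw [Finset.sum_eq_single l]
      · rw [herm_symm H (w l) (r l), hw]; simp
      · intro k _ hk
        rw [herm_symm H (w l) (r k), hw]; simp [hk, H.q0]
      · simp
    rw [h1, h2]
    simp only [hw'r, mul_ite, mul_one, mul_zero, Finset.sum_ite_eq', Finset.mem_univ, if_true]
    rw [mul_pow, ← herm_symm H]
    linear_combination (-herm q (w j) (w l)) * hu
  have hg : Gram q (Sum.elim r w') (Equiv.sumComm (Fin s) (Fin s)) := by
    rintro (a | a) (c | c)
    · simp [hrr]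
    · simp [hrw', eq_comm]
    · simp [hw'r]
    · simp [hw'w']
  have hgW : ∀ a, Sum.elim r w' a ∈ W := by
    rintro (a | a)
    · exact hrW a
    · exact hw'W a
  have hfr := finrank_inf_polar H hW hg.li hgW
  obtain ⟨e, heW, he⟩ := exists_onb H t _ (hg.nd H hW hgW) (by
    rw [Fintype.card_sum, Fintype.card_fin] at hfr; omega)
  refine ⟨Sum.elim (Sum.elim r w') e, ?_, ?_, fun j => rfl⟩
  · rintro (a | a)
    · exact hgW a
    · exact (heW a).1
  · exact hg.sum H he fun a c => herm_eq_zero_symm H ((mem_polar_span H).1 (heW c).2 a)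

/-- A nondegenerate complement of the radical through a given isotropic point. -/
theorem exists_compl (H : Cj q F) {π : Submodule F (Fin m → F)} {v : Fin m → F} (hv : v ∈ π)
    (hvR : v ∉ π ⊓ polar q π) :
    ∃ U ≤ π, Nd q U ∧ v ∈ U ∧ U ⊓ (π ⊓ polar q π) = ⊥ ∧
      Module.finrank F U + Module.finrank F ↥(π ⊓ polar q π) = Module.finrank F π := by
  set R := π ⊓ polar q π with hR
  have hdis : Disjoint (Submodule.span F {v}) R := by
    rw [disjoint_comm, Submodule.disjoint_span_singleton']
    · exact hvR
    · rintro rfl; exact hvR (Submodule.zero_mem _)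
  obtain ⟨A, hA1, hA2⟩ := hdis.exists_isCompl
  have hRπ : R ≤ π := inf_le_left
  have hdd : (A ⊓ π) ⊓ R = ⊥ := by
    rw [eq_bot_iff]
    rintro x ⟨⟨hx, _⟩, hx2⟩
    exact hA2.disjoint.le_bot ⟨hx, hx2⟩
  have hsup : R ⊔ A ⊓ π = π := by
    rw [← sup_inf_assoc_of_le A hRπ, sup_comm, hA2.sup_eq_top, top_inf_eq]
  refine ⟨A ⊓ π, inf_le_right, ?_, ?_, hdd, ?_⟩
  · rintro x hxA hx
    have hxR : x ∈ R := by
      refine ⟨hxA.2, mem_polar.2 fun z hz => ?_⟩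
      rw [← hsup] at hz
      obtain ⟨ρ, hρ, u, hu, rfl⟩ := Submodule.mem_sup.1 hz
      rw [herm_add_right H, herm_eq_zero_symm H (hx u hu),
        herm_eq_zero_symm H (mem_polar.1 hρ.2 x hxA.2), add_zero]
    have : x ∈ (A ⊓ π) ⊓ R := ⟨hxA, hxR⟩
    rwa [hdd, Submodule.mem_bot] at this
  · exact ⟨hA1 (Submodule.mem_span_singleton_self v), hv⟩
  · have := Submodule.finrank_sup_add_finrank_inf_eq (A ⊓ π) R
    rw [hdd, sup_comm, hsup, finrank_bot] at this
    omega

theorem exists_span_point {P : Submodule F (Fin m → F)} (hP : Module.finrank F P = 1) :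
    ∃ v, v ≠ 0 ∧ P = Submodule.span F {v} := by
  obtain ⟨⟨v, hv⟩, hv0, h⟩ := finrank_eq_one_iff'.1 hP
  refine ⟨v, by simpa using hv0, le_antisymm ?_ ?_⟩
  · intro x hx
    obtain ⟨c, hc⟩ := h ⟨x, hx⟩
    exact Submodule.mem_span_singleton.2 ⟨c, congrArg Subtype.val hc⟩
  · rw [Submodule.span_singleton_le_iff_mem]; exact hv

abbrev Ix (r t : ℕ) := (Jx 1 t ⊕ Jx 1 t) ⊕ Jx r 0

def It (r t : ℕ) : Equiv.Perm (Ix r t) :=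
  Equiv.sumCongr (Equiv.sumCongr (Jt 1 t) (Jt 1 t)) (Jt r 0)

def fI (r t : ℕ) : Jx 1 t ⊕ Fin r → Ix r t :=
  Sum.elim (fun a => Sum.inl (Sum.inl a)) (fun j => Sum.inr (Sum.inl (Sum.inl j)))

theorem fI_inj (r t : ℕ) : Function.Injective (fI r t) := by
  rintro (a | a) (c | c) h <;> simp_all [fI]

/-- Half of a frame: a standard basis of a nondegenerate complement to the radical. -/
theorem exists_half (H : Cj q F) {d r t : ℕ} (hd : d = r + (t + 2))
    {π P : Submodule F (Fin m → F)} (hπ : Module.finrank F π = d)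
    (hdim : Module.finrank F ↥(π ⊓ polar q π) = r)
    (hP : IsHermPoint q P) (hPπ : P ≤ π) (hPv : ¬ P ≤ π ⊓ polar q π) :
    ∃ b : Jx 1 t → Fin m → F, (∀ a, b a ∈ π) ∧ Gram q b (Jt 1 t) ∧
      P = Submodule.span F {b (Sum.inl (Sum.inl 0))} := by
  obtain ⟨hP1, hPi⟩ := hP
  obtain ⟨v, hv0, rfl⟩ := exists_span_point hP1
  rw [Submodule.span_singleton_le_iff_mem] at hPπ hPv
  obtain ⟨U, hUπ, hU, hvU, _, hfr⟩ := exists_compl H hPπ hPv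
  obtain ⟨b, hbU, hb, hbv⟩ := exists_std H 1 t hU (by omega) (r := fun _ => v)
    (linearIndependent_unique_iff.2 hv0) (fun _ => hvU)
    (fun _ _ => hPi v (Submodule.mem_span_singleton_self v))
  exact ⟨b, fun a => hUπ (hbU a), hb, by rw [hbv]⟩

theorem exists_frame (H : Cj q F) {n r t : ℕ} (hnr : n + 1 = r + (t + 2))
    {π P P' : Submodule F (Fin (2*n+2) → F)} (hπ : Module.finrank F π = n + 1)
    (hdim : Module.finrank F ↥(π ⊓ polar q π) = r)
    (hP : IsHermPoint q P) (hPπ : P ≤ π) (hPv : ¬ P ≤ π ⊓ polar q π)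
    (hP' : IsHermPoint q P') (hP'σ : P' ≤ polar q π) (hP'v : ¬ P' ≤ π ⊓ polar q π) :
    ∃ B : Ix r t → Fin (2*n+2) → F, Gram q B (It r t) ∧
      P = Submodule.span F {B (Sum.inl (Sum.inl (Sum.inl (Sum.inl 0))))} ∧
      P' = Submodule.span F {B (Sum.inl (Sum.inr (Sum.inl (Sum.inl 0))))} ∧
      π = Submodule.span F (Set.range (B ∘ fI r t)) := by
  have hpp := polar_polar H π
  have hinf : polar q π ⊓ polar q (polar q π) = π ⊓ polar q π := by rw [hpp, inf_comm]
  have hfp := finrank_polar H π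
  obtain ⟨b1, hb1π, hb1, hPb⟩ := exists_half H hnr hπ hdim hP hPπ hPv
  obtain ⟨b2, hb2π, hb2, hPb'⟩ := exists_half (π := polar q π) H hnr (by omega)
    (by rw [hinf]; exact hdim) hP' hP'σ (by rw [hinf]; exact hP'v)
  have h12 := hb1.sum H hb2
    (fun a c => herm_eq_zero_symm H (mem_polar.1 (hb2π c) _ (hb1π a)))
  have hfr := finrank_inf_polar H (nd_top H) h12.li (fun _ => trivial)
  have hN := h12.nd H (nd_top H) (fun _ => trivial)
  rw [finrank_top, Module.finrank_fin_fun] at hfr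
  simp only [Fintype.card_sum, Fintype.card_fin] at hfr
  let e := Module.finBasisOfFinrankEq F ↥(π ⊓ polar q π) hdim
  have hr : LinearIndependent F (fun j => (e j : Fin (2*n+2) → F)) :=
    e.linearIndependent.map' (Submodule.subtype _) (Submodule.ker_subtype _)
  have heR : ∀ j, (e j : Fin (2*n+2) → F) ∈ π ⊓ polar q π := fun j => (e j).2
  obtain ⟨b3, hb3N, hb3, hb3e⟩ := exists_std H r 0 hN (by omega) hr
    (by
      intro j
      refine ⟨trivial, (mem_polar_span H).2 ?_⟩
      rintro (a | a)
      · exact mem_polar.1 (heR j).2 _ (hb1π a)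
      · exact herm_eq_zero_symm H (mem_polar.1 (hb2π a) _ (heR j).1))
    (fun i j => mem_polar.1 (heR i).2 _ (heR j).1)
  have hB := h12.sum H hb3
    (fun a c => herm_eq_zero_symm H ((mem_polar_span H).1 (hb3N c).2 a))
  refine ⟨_, hB, hPb, hPb', ?_⟩
  symm
  apply Submodule.eq_of_le_of_finrank_eq
  · rw [Submodule.span_le]
    rintro _ ⟨a | j, rfl⟩
    · exact hb1π a
    · change b3 (Sum.inl (Sum.inl j)) ∈ π
      rw [hb3e]; exact (heR j).1
  · rw [finrank_span_eq_card (hB.li.comp _ (fI_inj r t)), hπ]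
    simp only [Fintype.card_sum, Fintype.card_fin]
    omega

theorem exists_isometry (H : Cj q F) {ι : Type*} [Fintype ι] [DecidableEq ι]
    {τ : Equiv.Perm ι} {B B' : ι → Fin m → F} (hB : Gram q B τ) (hB' : Gram q B' τ)
    (hc : Fintype.card ι = m) :
    ∃ g : (Fin m → F) ≃ₗ[F] (Fin m → F), (∀ a, g (B a) = B' a) ∧
      ∀ x y, herm q (g x) (g y) = herm q x y := by
  have hc' : Fintype.card ι = Module.finrank F (Fin m → F) := by rw [hc, Module.finrank_fin_fun]
  let β := basisOfLinearIndependentOfCardEqFinrank' _ hB.li hc'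
  let β' := basisOfLinearIndependentOfCardEqFinrank' _ hB'.li hc'
  have hβ : ∀ a, β a = B a := fun a => by simp [β]
  have hβ' : ∀ a, β' a = B' a := fun a => by simp [β']
  let g := β.equiv β' (Equiv.refl ι)
  have hg : ∀ a, g (B a) = B' a := by
    intro a
    rw [← hβ, ← hβ']
    simp [g]
  refine ⟨g, hg, fun x y => ?_⟩
  rw [← β.sum_repr x, ← β.sum_repr y]
  simp only [map_sum, map_smul, hβ, hg, herm_sum_left, herm_sum_right H, hB _ _, hB' _ _]

theorem polar_map (g : (Fin m → F) ≃ₗ[F] (Fin m → F))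
    (hg : ∀ x y, herm q (g x) (g y) = herm q x y) (W : Submodule F (Fin m → F)) :
    polar q (W.map (g : (Fin m → F) →ₗ[F] (Fin m → F)))
      = (polar q W).map (g : (Fin m → F) →ₗ[F] (Fin m → F)) := by
  ext y
  obtain ⟨y, rfl⟩ := g.surjective y
  rw [mem_polar]
  constructor
  · intro h
    refine ⟨y, mem_polar.2 fun x hx => ?_, rfl⟩
    rw [← hg]; exact h _ ⟨x, hx, rfl⟩
  · rintro ⟨z, hz, hzy⟩ _ ⟨x, hx, rfl⟩
    obtain rfl := g.injective hzy
    exact (hg _ _).trans (mem_polar.1 hz x hx)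

theorem isGenerator_map {n : ℕ} (g : (Fin (2*n+2) → F) ≃ₗ[F] (Fin (2*n+2) → F))
    (hg : ∀ x y, herm q (g x) (g y) = herm q x y) (W : Submodule F (Fin (2*n+2) → F)) :
    IsGenerator q n (W.map (g : (Fin (2*n+2) → F) →ₗ[F] (Fin (2*n+2) → F)))
      ↔ IsGenerator q n W := by
  unfold IsGenerator TotallyIsotropic
  rw [LinearEquiv.finrank_map_eq]
  refine and_congr_right fun _ => ⟨fun h x hx => ?_, ?_⟩
  · rw [← hg]; exact h _ ⟨x, hx, rfl⟩
  · rintro h _ ⟨x, hx, rfl⟩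
    exact (hg _ _).trans (h x hx)
end

/-- The number of generators meeting `π` exactly in the point `P` and `π^σ` exactly
in the point `P'` only depends on the intersection parameters `(n,i)`. -/
theorem stmt7 (n q p hh : ℕ) (hn : 2 ≤ n) (hp : p.Prime) (hh1 : 1 ≤ hh)
    (hq : q = p ^ hh)
    (F : Type) [Field F] [Fintype F] (hF : Fintype.card F = q ^ 2)
    (i : ℤ) (hi1 : -1 ≤ i) (hi2 : i ≤ (n:ℤ) - 2)
    (π π' : Submodule F (Fin (2*n+2) → F))
    (hπ : Module.finrank F π = n + 1) (hπ' : Module.finrank F π' = n + 1)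
    (hdim : (Module.finrank F ↥(π ⊓ polar q π) : ℤ) = i + 1)
    (hdim' : (Module.finrank F ↥(π' ⊓ polar q π') : ℤ) = i + 1)
    (P P' Q Q' : Submodule F (Fin (2*n+2) → F))
    (hP : IsHermPoint q P) (hPπ : P ≤ π) (hPv : ¬ P ≤ π ⊓ polar q π)
    (hP' : IsHermPoint q P') (hP'σ : P' ≤ polar q π) (hP'v : ¬ P' ≤ π ⊓ polar q π)
    (hQ : IsHermPoint q Q) (hQπ : Q ≤ π') (hQv : ¬ Q ≤ π' ⊓ polar q π')
    (hQ' : IsHermPoint q Q') (hQ'σ : Q' ≤ polar q π') (hQ'v : ¬ Q' ≤ π' ⊓ polar q π') :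
    Nat.card {μ : Submodule F (Fin (2*n+2) → F) //
        IsGenerator q n μ ∧ μ ⊓ π = P ∧ μ ⊓ polar q π = P'} =
    Nat.card {μ : Submodule F (Fin (2*n+2) → F) //
        IsGenerator q n μ ∧ μ ⊓ π' = Q ∧ μ ⊓ polar q π' = Q'} := by
  have H := cj_of_card q p hh hp hh1 hq F hF
  obtain ⟨r, hr⟩ : ∃ r : ℕ, (r : ℤ) = i + 1 := ⟨(i + 1).toNat, by omega⟩
  obtain ⟨t, ht⟩ : ∃ t : ℕ, n + 1 = r + (t + 2) := ⟨n + 1 - r - 2, by omega⟩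
  obtain ⟨B, hB, hBP, hBP', hBπ⟩ :=
    exists_frame H ht hπ (by omega) hP hPπ hPv hP' hP'σ hP'v
  obtain ⟨C, hC, hCQ, hCQ', hCπ⟩ :=
    exists_frame H ht hπ' (by omega) hQ hQπ hQv hQ' hQ'σ hQ'v
  obtain ⟨g, hgB, hg⟩ := exists_isometry H hB hC (by
    simp only [Fintype.card_sum, Fintype.card_fin]; omega)
  let G : (Fin (2*n+2) → F) →ₗ[F] (Fin (2*n+2) → F) := g
  have hGi : Function.Injective (Submodule.map G) :=
    Submodule.map_injective_of_injective g.injective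
  have e1 : P.map G = Q := by
    rw [hBP, hCQ, Submodule.map_span, Set.image_singleton, ← hgB]; rfl
  have e2 : P'.map G = Q' := by
    rw [hBP', hCQ', Submodule.map_span, Set.image_singleton, ← hgB]; rfl
  have e3 : π.map G = π' := by
    rw [hBπ, hCπ, Submodule.map_span, ← Set.range_comp]
    congr 2
    funext a
    exact hgB _
  have e4 : (polar q π).map G = polar q π' := by
    rw [← e3]; exact (polar_map g hg π).symm
  refine Nat.card_congr (Equiv.subtypeEquiv (Submodule.orderIsoMapComap g).toEquiv ?_)
  intro μ
  change _ ↔ IsGenerator q n (μ.map G) ∧ μ.map G ⊓ π' = Q ∧ μ.map G ⊓ polar q π' = Q'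
  rw [← e1, ← e2, ← e4, ← e3, ← Submodule.map_inf G g.injective, ← Submodule.map_inf G g.injective,
    hGi.eq_iff, hGi.eq_iff]
  exact and_congr_left fun _ => (isGenerator_map g hg μ).symm

end HermCode
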